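/- Let p be an odd prime and let G = D_{2p} be the dihedral group of order 2p. For every natural number n ≥ 4 with n ≡ 0 (mod 4), the group cohomology H^n(G; ℤ) with coefficients in the trivial representation ℤ is isomorphic to ℤ/2p. -/

import Mathlib

section

open CategoryTheory

namespace groupCohomology

section General

variable {k G : Type} [CommRing k] [Group G]

lemma map_map_eq_nsmul {A B : Rep k G} (f : A ⟶ B) (g : B ⟶ A) (m : ℕ)
    (h : ∀ a, g.hom (f.hom a) = m • a) (n : ℕ) (x : groupCohomology A n) :
    map (MonoidHom.id G) g n (map (MonoidHom.id G) f n x) = m • x := by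
  have hfg : f ≫ g = m • 𝟙 A := by
    ext a
    exact h a
  have : (cochainsFunctor k G ⋙ HomologicalComplex.homologyFunctor _ _ n).map (f ≫ g) =
      m • 𝟙 _ := by
    rw [hfg, Functor.map_nsmul, CategoryTheory.Functor.map_id]
  rw [Functor.map_comp] at this
  exact congr($this x)

lemma eq_zero_of_map_eq_zero {A B : Rep k G} (f : A ⟶ B) (g : B ⟶ A) (m : ℕ)
    (h : ∀ a, g.hom (f.hom a) = m • a) (n : ℕ) (x : groupCohomology A n)
    (hx : map (MonoidHom.id G) f n x = 0) : m • x = 0 := by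
  rw [← map_map_eq_nsmul f g m h, hx, map_zero]

/-- If multiplication by `m` on a representation factors through a representation coinduced from
the trivial group, then `m` annihilates the cohomology in positive degrees. -/
lemma nsmul_eq_zero_of_factors_coind_bot {A : Rep k G} (M : Rep k (⊥ : Subgroup G))
    (f : A ⟶ Rep.coind (⊥ : Subgroup G).subtype M) (g : Rep.coind (⊥ : Subgroup G).subtype M ⟶ A)
    (m : ℕ) (h : ∀ a, g.hom (f.hom a) = m • a) (n : ℕ) (x : groupCohomology A (n + 1)) :
    m • x = 0 := by
  refine eq_zero_of_map_eq_zero f g m h _ x ?_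
  have : Subsingleton (groupCohomology (Rep.coind (⊥ : Subgroup G).subtype M) (n + 1)) :=
    ModuleCat.subsingleton_of_isZero
      ((isZero_groupCohomology_succ_of_subsingleton M n).of_iso (coindIso M (n + 1)))
  exact Subsingleton.elim _ _

/-- Dimension shifting for torsion elements: if `m` annihilates `Hⁱ(G, X₂)` then a nonzero
`p`-torsion class in `Hⁱ(G, X₃)` with `p` coprime to `m` has nonzero image in `Hⁱ⁺¹(G, X₁)`. -/
lemma exists_torsion_of_shortExact {X : ShortComplex (Rep k G)} (hX : X.ShortExact) {i m p : ℕ}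
    (hm : ∀ x : groupCohomology X.X₂ i, m • x = 0) (hpm : p.Coprime m)
    (h : ∃ y : groupCohomology X.X₃ i, y ≠ 0 ∧ p • y = 0) :
    ∃ y : groupCohomology X.X₁ (i + 1), y ≠ 0 ∧ p • y = 0 := by
  obtain ⟨y, hy, hpy⟩ := h
  refine ⟨δ hX i (i + 1) rfl y, fun h0 ↦ hy ?_, by rw [← map_nsmul, hpy, map_zero]⟩
  obtain ⟨b, rfl⟩ := ((mapShortComplex₃ hX (j := i + 1) rfl).moduleCat_exact_iff.1
    (mapShortComplex₃_exact hX rfl)) y h0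
  have hmb := congr((mapShortComplex₃ hX (j := i + 1) rfl).f $(hm b))
  erw [map_nsmul, map_zero] at hmb
  have := AddMonoid.addOrderOf_eq_one_iff.1
    (Nat.eq_one_of_dvd_coprimes hpm (addOrderOf_dvd_of_nsmul_eq_zero hpy)
      (addOrderOf_dvd_of_nsmul_eq_zero hmb))
  exact this

end General

/-- The even positive cohomology of a finite cyclic group with trivial coefficients `ℤ`. -/
lemma nonempty_addEquiv_zmod_of_even {C : Type} [CommGroup C] [Finite C] (g : C)
    (hg : ∀ x, x ∈ Subgroup.zpowers g) (n : ℕ) (hn0 : n ≠ 0) (hn : Even n) :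
    Nonempty (groupCohomology (Rep.trivial ℤ C ℤ) n ≃+ ZMod (Nat.card C)) := by
  have := Fintype.ofFinite C
  have : NeZero n := ⟨hn0⟩
  let A := Rep.trivial ℤ C ℤ
  have hmem (z : ℤ) : z ∈ LinearMap.ker (Rep.applyAsHom A g - 𝟙 A).hom.toLinearMap :=
    LinearMap.mem_ker.2 (sub_self z)
  let ι : ℤ →+ LinearMap.ker (Rep.applyAsHom A g - 𝟙 A).hom.toLinearMap :=
    { toFun z := ⟨z, hmem z⟩
      map_zero' := rfl
      map_add' _ _ := rfl }
  let π := Rep.FiniteCyclicGroup.groupCohomologyπEven A g hg n hn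
  let φ : ℤ →+ groupCohomology A n := π.hom.toAddMonoidHom.comp ι
  have hφ : Function.Surjective φ := by
    have hπ : Epi π := by
      have h₁ := (Rep.FiniteCyclicGroup.normHomCompSub A g).moduleCatCyclesIso.isIso_inv
      exact epi_comp' (@IsIso.epi_of_iso _ _ _ _ _ h₁) (epi_comp' inferInstance inferInstance)
    exact ((ModuleCat.epi_iff_surjective π).1 hπ).comp fun x ↦ ⟨x.1, rfl⟩
  have hker : φ.ker = AddSubgroup.zmultiples (Nat.card C : ℤ) := by
    ext z
    rw [AddMonoidHom.mem_ker, AddSubgroup.mem_zmultiples_iff]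
    refine (Rep.FiniteCyclicGroup.groupCohomologyπEven_eq_zero_iff A g hg n hn ⟨z, hmem z⟩).trans ?_
    have hnorm (a : ℤ) : A.norm.hom.toLinearMap a = Nat.card C * a := by
      change A.ρ.norm a = _
      simp [A, Representation.norm, Nat.card_eq_fintype_card]
    simp only [LinearMap.mem_range, smul_eq_mul]
    exact exists_congr fun a ↦ by rw [hnorm, mul_comm]
  exact ⟨((QuotientAddGroup.quotientKerEquivOfSurjective φ hφ).symm.trans
    (QuotientAddGroup.quotientAddEquivOfEq hker)).trans (Int.quotientZMultiplesNatEquivZMod _)⟩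

end groupCohomology

namespace DihedralGroup

variable {p : ℕ}

/-- The character of the dihedral group that is trivial on rotations and has value `ε` on
reflections. -/
def character (ε : ℤˣ) : DihedralGroup p →* ℤˣ where
  toFun g := match g with
    | r _ => 1
    | sr _ => ε
  map_one' := rfl
  map_mul' g h := by
    rcases g with i | i <;> rcases h with j | j <;>
      simp [r_mul_r, r_mul_sr, sr_mul_r, sr_mul_sr, Int.units_mul_self]

@[simp] lemma character_r (ε : ℤˣ) (i : ZMod p) : character ε (r i) = 1 := rfl

@[simp] lemma character_sr (ε : ℤˣ) (i : ZMod p) : character ε (sr i) = ε := rfl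

/-- A right action of the dihedral group on the vertices of the `p`-gon, in which `sr i` is the
reflection `x ↦ i - c - x`. -/
def rightAct (c : ZMod p) (g : DihedralGroup p) (x : ZMod p) : ZMod p :=
  match g with
  | r i => x + i
  | sr i => i - c - x

@[simp] lemma rightAct_r (c i x : ZMod p) : rightAct c (r i) x = x + i := rfl

@[simp] lemma rightAct_sr (c i x : ZMod p) : rightAct c (sr i) x = i - c - x := rfl

lemma rightAct_mul (c : ZMod p) (g h : DihedralGroup p) (x : ZMod p) :
    rightAct c (g * h) x = rightAct c h (rightAct c g x) := by
  rcases g with i | i <;> rcases h with j | j <;>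
    simp only [r_mul_r, r_mul_sr, sr_mul_r, sr_mul_sr, rightAct_r, rightAct_sr] <;> ring

lemma rightAct_bijective (c : ZMod p) (g : DihedralGroup p) :
    Function.Bijective (rightAct c g) := by
  rcases g with i | i
  · exact (Equiv.addRight i).bijective
  · exact (Equiv.subLeft (i - c)).bijective

/-- The one-dimensional integral representation afforded by `character ε`. -/
def signRep (ε : ℤˣ) : Representation ℤ (DihedralGroup p) ℤ where
  toFun g := ((character ε g : ℤˣ) : ℤ) • LinearMap.id
  map_one' := by ext; simp
  map_mul' g h := by ext; simp

@[simp] lemma signRep_apply (ε : ℤˣ) (g : DihedralGroup p) (a : ℤ) :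
    signRep ε g a = character ε g * a := rfl

lemma signRep_one : signRep 1 = Representation.trivial ℤ (DihedralGroup p) ℤ := by
  ext g
  rcases g with i | i <;> simp

/-- The integral permutation representation of the dihedral group on functions on the vertices of
the `p`-gon, twisted by `character ε`. -/
def vertexRep (ε : ℤˣ) (c : ZMod p) : Representation ℤ (DihedralGroup p) (ZMod p → ℤ) where
  toFun g := ((character ε g : ℤˣ) : ℤ) • LinearMap.funLeft ℤ ℤ (rightAct c g)
  map_one' := by
    refine LinearMap.ext fun v ↦ funext fun x ↦ ?_
    change (1 : ℤ) * v (x + 0) = v x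
    simp
  map_mul' g h := by
    refine LinearMap.ext fun v ↦ funext fun x ↦ ?_
    simp [LinearMap.funLeft_apply, rightAct_mul, mul_assoc]

@[simp] lemma vertexRep_apply (ε : ℤˣ) (c : ZMod p) (g : DihedralGroup p) (v : ZMod p → ℤ)
    (x : ZMod p) : vertexRep ε c g v x = character ε g * v (rightAct c g x) := rfl

section NeZero

variable [NeZero p]

/-- The sum of the values of a function, as a map from `vertexRep` to `signRep`. -/
def sumMap (ε : ℤˣ) (c : ZMod p) : Rep.of (vertexRep ε c) ⟶ Rep.of (signRep ε) :=
  Rep.ofHom ⟨Fintype.linearCombination ℤ (fun _ : ZMod p ↦ (1 : ℤ)), fun g ↦ by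
    refine LinearMap.ext fun v ↦ ?_
    simp [Fintype.linearCombination_apply, ← Finset.mul_sum,
      (rightAct_bijective c g).sum_comp v]⟩

lemma sumMap_apply (ε : ℤˣ) (c : ZMod p) (v : ZMod p → ℤ) :
    (sumMap ε c).hom v = ∑ x, v x := by
  change Fintype.linearCombination ℤ (fun _ : ZMod p ↦ (1 : ℤ)) v = _
  simp [Fintype.linearCombination_apply]

/-- The functions with sum zero. -/
def sumZero (p : ℕ) [NeZero p] : Submodule ℤ (ZMod p → ℤ) :=
  LinearMap.ker (Fintype.linearCombination ℤ (fun _ : ZMod p ↦ (1 : ℤ)))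

lemma mem_sumZero {v : ZMod p → ℤ} : v ∈ sumZero p ↔ ∑ x, v x = 0 := by
  simp [sumZero, Fintype.linearCombination_apply]

/-- The representation on functions with sum zero on the vertices of the `p`-gon. -/
abbrev sumZeroRep (ε : ℤˣ) (c : ZMod p) : Rep ℤ (DihedralGroup p) :=
  Rep.subrepresentation (Rep.of (vertexRep ε c)) (sumZero p) fun g v hv ↦ by
    have hv : ∑ x, v x = 0 := mem_sumZero.1 hv
    change vertexRep ε c g v ∈ sumZero p
    simp [mem_sumZero, ← Finset.mul_sum, (rightAct_bijective c g).sum_comp v, hv]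

/-- The short complex `sumZeroRep ⟶ vertexRep ⟶ signRep`. -/
def sumComplex (ε : ℤˣ) (c : ZMod p) : ShortComplex (Rep ℤ (DihedralGroup p)) where
  X₁ := sumZeroRep ε c
  X₂ := Rep.of (vertexRep ε c)
  X₃ := Rep.of (signRep ε)
  f := Rep.subtype _ _ _
  g := sumMap ε c
  zero := by
    ext v
    exact (sumMap_apply ε c v.1).trans (mem_sumZero.1 v.2)

/-- The inclusion of constant functions. -/
def constMap (ε : ℤˣ) (c : ZMod p) : Rep.of (signRep ε) ⟶ Rep.of (vertexRep ε c) :=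
  Rep.ofHom ⟨LinearMap.pi fun _ ↦ LinearMap.id, fun g ↦ by
    refine LinearMap.ext fun v ↦ funext fun x ↦ ?_
    simp⟩

/-- The difference operator on functions on the vertices of the `p`-gon. -/
def diffMap (ε : ℤˣ) (c : ZMod p) : Rep.of (vertexRep ε c) ⟶ sumZeroRep (-ε) (c + 1) :=
  Rep.ofHom ⟨LinearMap.codRestrict (sumZero p)
      (LinearMap.funLeft ℤ ℤ (fun x : ZMod p ↦ x + 1) - LinearMap.id) fun v ↦ by
        rw [mem_sumZero]
        simp [LinearMap.funLeft_apply,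
          show ∑ x, v (x + 1) = ∑ x, v x from Equiv.sum_comp (Equiv.addRight (1 : ZMod p)) v],
    fun g ↦ by
      refine LinearMap.ext fun v ↦ Subtype.ext <| funext fun x ↦ ?_
      change vertexRep ε c g v (x + 1) - vertexRep ε c g v x =
        character (-ε) g * (v (rightAct (c + 1) g x + 1) - v (rightAct (c + 1) g x))
      rcases g with i | i
      · simp [add_right_comm]
      · simp only [vertexRep_apply, character_sr, rightAct_sr]
        rw [show i - (c + 1) - x + 1 = i - c - x by ring,
          show i - c - (x + 1) = i - (c + 1) - x by ring]
        push_cast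
        ring⟩

/-- The short complex `signRep ⟶ vertexRep ⟶ sumZeroRep`. -/
def diffComplex (ε : ℤˣ) (c : ZMod p) : ShortComplex (Rep ℤ (DihedralGroup p)) where
  X₁ := Rep.of (signRep ε)
  X₂ := Rep.of (vertexRep ε c)
  X₃ := sumZeroRep (-ε) (c + 1)
  f := constMap ε c
  g := diffMap ε c
  zero := by
    ext v
    exact sub_self (1 : ℤ)

lemma shortExact_of_injective_of_surjective {k G : Type} [CommRing k] [Group G]
    (X : ShortComplex (Rep k G)) (hf : Function.Injective X.f.hom)
    (hg : Function.Surjective X.g.hom)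
    (hX : ∀ x, X.g.hom x = 0 → ∃ y, X.f.hom y = x) : X.ShortExact where
  exact := by
    have h : (X.map (forget₂ (Rep k G) (ModuleCat k))).Exact :=
      (ShortComplex.moduleCat_exact_iff _).2 hX
    exact (ShortComplex.exact_map_iff_of_faithful _ _).1 h
  mono_f := (Rep.mono_iff_injective _).2 hf
  epi_g := (Rep.epi_iff_surjective _).2 hg

lemma sumComplex_shortExact (ε : ℤˣ) (c : ZMod p) : (sumComplex ε c).ShortExact := by
  refine shortExact_of_injective_of_surjective _ Subtype.val_injective
    (fun (a : ℤ) ↦ ?_) fun v hv ↦ ?_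
  · refine ⟨(Pi.single 0 a : ZMod p → ℤ), (sumMap_apply ε c _).trans ?_⟩
    change ∑ x : ZMod p, (Pi.single 0 a : ZMod p → ℤ) x = a
    simp
  · exact ⟨⟨v, mem_sumZero.2 ((sumMap_apply ε c v).symm.trans hv)⟩, rfl⟩

lemma exists_diff_eq {u : ZMod p → ℤ} (hu : ∑ x, u x = 0) :
    ∃ v : ZMod p → ℤ, ∀ x, v (x + 1) - v x = u x := by
  refine ⟨fun x ↦ ∑ j ∈ Finset.range x.val, u j, fun x ↦ ?_⟩
  have hsum : ∑ j ∈ Finset.range p, u j = 0 := by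
    rw [← hu]
    refine Finset.sum_bij (fun j _ ↦ (j : ZMod p)) (by simp) (fun i hi j hj h ↦ ?_)
      (fun x _ ↦ ⟨x.val, by simp [ZMod.val_lt], by simp⟩) (by simp)
    rw [← ZMod.val_cast_of_lt (Finset.mem_range.1 hi), h,
      ZMod.val_cast_of_lt (Finset.mem_range.1 hj)]
  have hx : u x = u (x.val : ZMod p) := by simp
  rcases (Nat.succ_le_of_lt (ZMod.val_lt x)).lt_or_eq with h | h
  · have hval := ZMod.val_cast_of_lt h
    rw [Nat.succ_eq_add_one, Nat.cast_add_one, ZMod.natCast_zmod_val] at hval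
    beta_reduce
    rw [hval, Finset.sum_range_succ, hx]
    ring
  · have h0 : x + 1 = 0 := by
      have := congr(($h : ZMod p))
      simpa using this
    have hs : ∑ j ∈ Finset.range (x.val + 1), u j = 0 := by
      rw [← hsum]
      congr 2
    rw [Finset.sum_range_succ] at hs
    simp only [h0, ZMod.val_zero, Finset.range_zero, Finset.sum_empty]
    rw [hx]
    linarith

lemma diffComplex_shortExact (ε : ℤˣ) (c : ZMod p) : (diffComplex ε c).ShortExact := by
  refine shortExact_of_injective_of_surjective _ (fun a b hab ↦ congr_fun hab (0 : ZMod p))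
    (fun u ↦ ?_) fun (v : ZMod p → ℤ) hv ↦ ⟨v 0, funext fun x ↦ ?_⟩
  · obtain ⟨v, hv⟩ := exists_diff_eq (mem_sumZero.1 u.2)
    exact ⟨v, Subtype.ext <| funext hv⟩
  · have hstep (y : ZMod p) : v (y + 1) = v y :=
      sub_eq_zero.1 (congr_fun (congrArg Subtype.val hv) y)
    have hnat (m : ℕ) : v (m : ZMod p) = v 0 := by
      induction m with
      | zero => simp
      | succ m ih => rw [Nat.cast_succ, hstep, ih]
    change v 0 = v x
    rw [← hnat x.val]
    simp

end NeZero

end DihedralGroup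

namespace groupCohomology

section Transfer

variable {G : Type} [Group G]

/-- The embedding of the trivial representation in the representation coinduced from a subgroup. -/
noncomputable def toCoindTrivial (S : Subgroup G) :
    Rep.trivial ℤ G ℤ ⟶ Rep.coind S.subtype (Rep.trivial ℤ S ℤ) :=
  Rep.resCoindToHom S.subtype (Rep.trivial ℤ G ℤ) (Rep.trivial ℤ S ℤ)
    (Rep.ofHom ⟨LinearMap.id, fun _ ↦ rfl⟩)

/-- Summation over a family of coset representatives. -/
noncomputable def ofCoindTrivial (S : Subgroup G) {ι : Type} [Fintype ι] (t : ι → G)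
    (ht : ∀ F : G → ℤ, (∀ s ∈ S, ∀ g, F (s * g) = F g) → ∀ g, ∑ i, F (t i * g) = ∑ i, F (t i)) :
    Rep.coind S.subtype (Rep.trivial ℤ S ℤ) ⟶ Rep.trivial ℤ G ℤ :=
  Rep.ofHom ⟨(∑ i, LinearMap.proj (t i)) ∘ₗ Submodule.subtype _, fun g ↦ by
    refine LinearMap.ext fun F ↦ ?_
    have := ht F.1 (fun s hs h ↦ F.2 ⟨s, hs⟩ h) g
    simp only [LinearMap.comp_apply, LinearMap.sum_apply]
    exact this⟩

/-- The integral cohomology of `G` maps to that of a cyclic subgroup in even degrees, with kernel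
annihilated by the index. -/
lemma exists_addMonoidHom_zmod (a : G) [Finite (Subgroup.zpowers a)] {ι : Type} [Fintype ι]
    (t : ι → G)
    (ht : ∀ F : G → ℤ, (∀ s ∈ Subgroup.zpowers a, ∀ g, F (s * g) = F g) →
      ∀ g, ∑ i, F (t i * g) = ∑ i, F (t i)) (n : ℕ) (hn0 : n ≠ 0) (hn : Even n) :
    ∃ φ : groupCohomology (Rep.trivial ℤ G ℤ) n →+ ZMod (orderOf a),
      ∀ x, φ x = 0 → Fintype.card ι • x = 0 := by
  let : CommGroup (Subgroup.zpowers a) :=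
    { (inferInstance : Group (Subgroup.zpowers a)) with
      mul_comm := by
        rintro ⟨_, k, rfl⟩ ⟨_, l, rfl⟩
        exact Subtype.ext (zpow_mul_comm a k l) }
  obtain ⟨e⟩ := nonempty_addEquiv_zmod_of_even (⟨a, Subgroup.mem_zpowers a⟩ : Subgroup.zpowers a)
    (by
      rintro ⟨_, m, rfl⟩
      exact ⟨m, Subtype.ext rfl⟩) n hn0 hn
  rw [Nat.card_zpowers] at e
  refine ⟨e.toAddMonoidHom.comp
    ((coindIso (Rep.trivial ℤ (Subgroup.zpowers a) ℤ) n).toLinearEquiv.toLinearMap ∘ₗ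
      (map (MonoidHom.id G) (toCoindTrivial (Subgroup.zpowers a)) n).hom).toAddMonoidHom,
    fun x hx ↦ eq_zero_of_map_eq_zero (toCoindTrivial _) (ofCoindTrivial _ t ht) _
      (fun z ↦ ?_) n x ?_⟩
  · change ((∑ i, LinearMap.proj (t i)) : (G → ℤ) →ₗ[ℤ] ℤ) (fun _ ↦ z) = _
    simp
  · exact (coindIso (Rep.trivial ℤ (Subgroup.zpowers a) ℤ) n).toLinearEquiv.injective
      ((e.injective (hx.trans (map_zero e).symm)).trans (map_zero _).symm)

/-- Cohomology with trivial coefficients of a retract is a direct summand. -/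
lemma exists_injective_of_retract {H : Type} [Group H] (π : G →* H) (s : H →* G)
    (h : π.comp s = MonoidHom.id H) (n : ℕ) :
    ∃ φ : groupCohomology (Rep.trivial ℤ H ℤ) n →+ groupCohomology (Rep.trivial ℤ G ℤ) n,
      Function.Injective φ := by
  let F : groupCohomology (Rep.trivial ℤ H ℤ) n ⟶ groupCohomology (Rep.trivial ℤ G ℤ) n :=
    map π (Rep.ofHom ⟨LinearMap.id, fun _ ↦ rfl⟩ :
      Rep.res π (Rep.trivial ℤ H ℤ) ⟶ Rep.trivial ℤ G ℤ) n
  let E : groupCohomology (Rep.trivial ℤ G ℤ) n ⟶ groupCohomology (Rep.trivial ℤ H ℤ) n :=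
    map s (Rep.ofHom ⟨LinearMap.id, fun _ ↦ rfl⟩ :
      Rep.res s (Rep.trivial ℤ G ℤ) ⟶ Rep.trivial ℤ H ℤ) n
  have hF : F ≫ E = 𝟙 _ := by
    rw [← map_comp, ← map_id]
    exact map_congr h rfl n
  exact ⟨F.hom.toAddMonoidHom, Function.LeftInverse.injective (g := E.hom) fun x ↦ congr($hF x)⟩

end Transfer

end groupCohomology

lemma AddCommGroup.nonempty_addEquiv_zmod_two_mul {H : Type*} [AddCommGroup H] {p : ℕ}
    (hp : p.Prime) (hodd : Odd p) (φ : H →+ ZMod p) (ψ : H →+ ZMod 2)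
    (hφ : ∀ x, φ x = 0 → 2 • x = 0) (hψ : ∀ x, ψ x = 0 → p • x = 0) (hx : ∃ x : H, x ≠ 0 ∧ 2 • x = 0)
    (hy : ∃ y : H, y ≠ 0 ∧ p • y = 0) : Nonempty (H ≃+ ZMod (2 * p)) := by
  have : NeZero p := ⟨hp.ne_zero⟩
  have h2 : Nat.Coprime 2 p := Nat.coprime_two_left.2 hodd
  have hinj : Function.Injective (ψ.prod φ) := by
    refine (injective_iff_map_eq_zero _).2 fun x hx ↦ ?_
    rw [AddMonoidHom.prod_apply, Prod.mk_eq_zero] at hx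
    exact AddMonoid.addOrderOf_eq_one_iff.1 (Nat.eq_one_of_dvd_coprimes h2
      (addOrderOf_dvd_of_nsmul_eq_zero (hφ x hx.2)) (addOrderOf_dvd_of_nsmul_eq_zero (hψ x hx.1)))
  have : Finite H := Finite.of_injective _ hinj
  have hdvd (q : ℕ) (hq : q.Prime) (h : ∃ x : H, x ≠ 0 ∧ q • x = 0) : q ∣ Nat.card H := by
    obtain ⟨x, hx0, hqx⟩ := h
    have := Fact.mk hq
    rw [← addOrderOf_eq_prime hqx hx0]
    exact addOrderOf_dvd_natCard x
  have hcard : Nat.card (ZMod 2 × ZMod p) ≤ Nat.card H := by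
    rw [Nat.card_prod, Nat.card_zmod, Nat.card_zmod]
    exact Nat.le_of_dvd Nat.card_pos
      (h2.mul_dvd_of_dvd_of_dvd (hdvd 2 Nat.prime_two hx) (hdvd p hp hy))
  have hbij : Function.Bijective (ψ.prod φ) := hinj.bijective_of_nat_card_le hcard
  exact ⟨(AddEquiv.ofBijective _ hbij).trans (ZMod.chineseRemainder h2).toAddEquiv.symm⟩

namespace DihedralGroup

open groupCohomology

variable {p : ℕ}

/-- Evaluation of the translates of a function at `0`. -/
noncomputable def vertexToCoind (ε : ℤˣ) (c : ZMod p) : Rep.of (vertexRep ε c) ⟶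
    Rep.coind (⊥ : Subgroup (DihedralGroup p)).subtype (Rep.trivial ℤ _ ℤ) :=
  Rep.resCoindToHom _ (Rep.of (vertexRep ε c)) (Rep.trivial ℤ _ ℤ)
    (Rep.ofHom ⟨LinearMap.proj 0, fun g ↦ by
      obtain rfl := Subsingleton.elim g 1
      refine LinearMap.ext fun v ↦ ?_
      change vertexRep ε c 1 v 0 = v 0
      rw [map_one]
      rfl⟩)

/-- Signed summation over the two group elements carrying `0` to a given vertex. -/
noncomputable def coindToVertex (ε : ℤˣ) (c : ZMod p) :
    Rep.coind (⊥ : Subgroup (DihedralGroup p)).subtype (Rep.trivial ℤ _ ℤ) ⟶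
      Rep.of (vertexRep ε c) :=
  Rep.ofHom ⟨(LinearMap.funLeft ℤ ℤ r + (ε : ℤ) • LinearMap.funLeft ℤ ℤ fun x ↦ sr (x + c)) ∘ₗ
    Submodule.subtype _, fun g ↦ by
    refine LinearMap.ext fun F ↦ funext fun x ↦ ?_
    change F.1 (r x * g) + ε * F.1 (sr (x + c) * g) =
      character ε g * (F.1 (r (rightAct c g x)) + ε * F.1 (sr (rightAct c g x + c)))
    rcases g with i | i
    · simp [add_right_comm]
    · have hε : (ε : ℤ) * ε = 1 := by rw [← Units.val_mul, Int.units_mul_self, Units.val_one]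
      simp only [r_mul_sr, sr_mul_sr, character_sr, rightAct_sr]
      rw [show i - c - x + c = i - x by ring, show i - (x + c) = i - c - x by ring, mul_add,
        ← mul_assoc, hε]
      ring⟩

lemma two_nsmul_vertexRep (ε : ℤˣ) (c : ZMod p) (n : ℕ)
    (x : groupCohomology (Rep.of (vertexRep ε c)) (n + 1)) : 2 • x = 0 := by
  refine nsmul_eq_zero_of_factors_coind_bot _ (vertexToCoind ε c) (coindToVertex ε c) 2
    (fun v ↦ funext fun x ↦ ?_) n x
  change vertexRep ε c (r x) v 0 + ε * vertexRep ε c (sr (x + c)) v 0 = (2 • v : ZMod p → ℤ) x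
  have hε : (ε : ℤ) * ε = 1 := by rw [← Units.val_mul, Int.units_mul_self, Units.val_one]
  simp [← mul_assoc, hε]
  ring

/-- The section of `character (-1)` with values in the subgroup generated by a reflection. -/
def reflectionHom (p : ℕ) : ℤˣ →* DihedralGroup p where
  toFun u := if u = 1 then 1 else sr 0
  map_one' := rfl
  map_mul' u v := by
    rcases Int.units_eq_one_or u with rfl | rfl <;> rcases Int.units_eq_one_or v with rfl | rfl <;>
      simp

lemma character_comp_reflectionHom (p : ℕ) :
    (character (p := p) (-1)).comp (reflectionHom p) = MonoidHom.id ℤˣ := by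
  refine MonoidHom.ext fun u ↦ ?_
  rcases Int.units_eq_one_or u with rfl | rfl <;> rfl

lemma exists_two_torsion (n : ℕ) (hn0 : n ≠ 0) (hn : Even n) :
    ∃ x : groupCohomology (Rep.trivial ℤ (DihedralGroup p) ℤ) n, x ≠ 0 ∧ 2 • x = 0 := by
  obtain ⟨φ, hφ⟩ := exists_injective_of_retract _ _ (character_comp_reflectionHom p) n
  obtain ⟨e⟩ := nonempty_addEquiv_zmod_of_even (-1 : ℤˣ) (fun u ↦ by
    rcases Int.units_eq_one_or u with rfl | rfl
    · exact one_mem _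
    · exact Subgroup.mem_zpowers _) n hn0 hn
  rw [Nat.card_eq_fintype_card, Fintype.card_units_int] at e
  refine ⟨φ (e.symm 1), fun h ↦ ?_, ?_⟩
  · have := (map_eq_zero_iff φ hφ).1 h
    rw [map_eq_zero_iff _ e.symm.injective] at this
    exact one_ne_zero this
  · rw [← map_nsmul, ← map_nsmul, show 2 • (1 : ZMod 2) = 0 from rfl, map_zero, map_zero]

variable [NeZero p]

lemma exists_torsion_sumZeroRep_one (hp : p ≠ 1) (c : ZMod p) :
    ∃ y : groupCohomology (sumZeroRep (1 : ℤˣ) c) 1, y ≠ 0 ∧ p • y = 0 := by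
  have hX := sumComplex_shortExact (1 : ℤˣ) c
  let one : (Rep.of (signRep (p := p) 1)).ρ.invariants := ⟨(1 : ℤ), fun g ↦ by
    rw [signRep_one]; rfl⟩
  let ones : (Rep.of (vertexRep (1 : ℤˣ) c)).ρ.invariants := ⟨fun _ ↦ (1 : ℤ), fun g ↦ by
    refine funext fun x ↦ ?_
    rcases g with i | i <;> simp⟩
  have hexact := (mapShortComplex₃ hX (j := 1) rfl).moduleCat_exact_iff.1
    (mapShortComplex₃_exact hX rfl)
  have hmap (b : groupCohomology (Rep.of (vertexRep (1 : ℤˣ) c)) 0) :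
      ((H0Iso (Rep.of (signRep 1))).hom (map (MonoidHom.id _) (sumMap 1 c) 0 b)).1 =
        ∑ x, (((H0Iso (Rep.of (vertexRep 1 c))).hom b).1 : ZMod p → ℤ) x :=
    (congrArg Subtype.val congr($(map_id_comp_H0Iso_hom (sumMap (1 : ℤˣ) c)) b)).trans
      (sumMap_apply 1 c _)
  refine ⟨δ hX 0 1 rfl ((H0Iso (Rep.of (signRep 1))).inv one), fun h0 ↦ ?_, ?_⟩
  · obtain ⟨b, hb⟩ := hexact _ h0
    set v := (H0Iso (Rep.of (vertexRep 1 c))).hom b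
    have hv (x : ZMod p) : (v.1 : ZMod p → ℤ) x = (v.1 : ZMod p → ℤ) 0 := by
      have h : vertexRep 1 c (r x) v.1 0 = (v.1 : ZMod p → ℤ) 0 := congr_fun (v.2 (r x)) 0
      simpa using h
    have hone : (H0Iso (Rep.of (signRep 1))).hom (map (MonoidHom.id _) (sumMap 1 c) 0 b) = one := by
      refine (congrArg _ hb).trans ?_
      exact congr($((H0Iso (Rep.of (signRep 1))).inv_hom_id) one)
    have hsum : (1 : ℤ) = _ := (congrArg Subtype.val hone).symm.trans (hmap b)
    rw [Finset.sum_congr rfl fun x _ ↦ hv x, Finset.sum_const, Finset.card_univ,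
      ZMod.card, nsmul_eq_mul] at hsum
    have hdvd : (p : ℤ) ∣ 1 := ⟨_, hsum⟩
    exact hp (Nat.dvd_one.1 (by exact_mod_cast hdvd))
  · have h : map (MonoidHom.id _) (sumMap 1 c) 0 ((H0Iso (Rep.of (vertexRep 1 c))).inv ones) =
        p • (H0Iso (Rep.of (signRep 1))).inv one := by
      apply (H0Iso (Rep.of (signRep 1))).toLinearEquiv.injective
      rw [map_nsmul]
      refine Subtype.ext ((hmap _).trans ?_)
      have h1 : (H0Iso (Rep.of (vertexRep 1 c))).hom
          ((H0Iso (Rep.of (vertexRep 1 c))).inv ones) = ones :=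
        congr($((H0Iso (Rep.of (vertexRep 1 c))).inv_hom_id) ones)
      have h2 : (H0Iso (Rep.of (signRep (p := p) 1))).toLinearEquiv
          ((H0Iso (Rep.of (signRep 1))).inv one) = one :=
        congr($((H0Iso (Rep.of (signRep 1))).inv_hom_id) one)
      rw [h1, h2]
      change ∑ x : ZMod p, (1 : ℤ) = p • (1 : ℤ)
      simp
    exact (map_nsmul (δ hX 0 1 rfl).hom p _).symm.trans ((congrArg _ h.symm).trans
      congr($((mapShortComplex₃ hX (j := 1) rfl).zero)
        ((H0Iso (Rep.of (vertexRep 1 c))).inv ones)))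

lemma exists_torsion_signRep_add_two (hp : Odd p) (ε : ℤˣ) (n : ℕ)
    (h : ∃ y : groupCohomology (Rep.of (signRep (p := p) ε)) (n + 1), y ≠ 0 ∧ p • y = 0) :
    ∃ y : groupCohomology (Rep.of (signRep (p := p) (-ε))) (n + 3), y ≠ 0 ∧ p • y = 0 := by
  have h2 : p.Coprime 2 := Nat.coprime_two_right.2 hp
  have h1 := exists_torsion_of_shortExact (sumComplex_shortExact ε (0 + 1 : ZMod p))
    (two_nsmul_vertexRep ε _ n) h2 h
  rw [← neg_neg ε] at h1
  exact exists_torsion_of_shortExact (diffComplex_shortExact (-ε) (0 : ZMod p))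
    (two_nsmul_vertexRep (-ε) _ (n + 1)) h2 (by simpa using! h1)

lemma exists_torsion_signRep_two (hp : Odd p) (hp1 : p ≠ 1) :
    ∃ y : groupCohomology (Rep.of (signRep (p := p) (-1))) 2, y ≠ 0 ∧ p • y = 0 := by
  have h2 : p.Coprime 2 := Nat.coprime_two_right.2 hp
  have h1 := exists_torsion_sumZeroRep_one hp1 (0 + 1 : ZMod p)
  rw [← neg_neg (1 : ℤˣ)] at h1
  exact exists_torsion_of_shortExact (diffComplex_shortExact (-1) (0 : ZMod p))
    (two_nsmul_vertexRep (-1) _ 0) h2 h1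

lemma exists_torsion_trivial (hp : Odd p) (hp1 : p ≠ 1) (k : ℕ) :
    ∃ y : groupCohomology (Rep.trivial ℤ (DihedralGroup p) ℤ) (4 * k + 4), y ≠ 0 ∧ p • y = 0 := by
  have h : ∃ y : groupCohomology (Rep.of (signRep (p := p) 1)) (4 * k + 4), y ≠ 0 ∧ p • y = 0 := by
    induction k with
    | zero =>
      simpa using! exists_torsion_signRep_add_two hp (-1) 1 (exists_torsion_signRep_two hp hp1)
    | succ k ih =>
      simpa using! exists_torsion_signRep_add_two hp (-1) (4 * k + 5)
        (exists_torsion_signRep_add_two hp 1 (4 * k + 3) ih)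
  rwa [signRep_one] at h

lemma exists_addMonoidHom_zmod_rotations (n : ℕ) (hn0 : n ≠ 0) (hn : Even n) :
    ∃ φ : groupCohomology (Rep.trivial ℤ (DihedralGroup p) ℤ) n →+ ZMod p,
      ∀ x, φ x = 0 → 2 • x = 0 := by
  have hr (i : ZMod p) : r i ∈ Subgroup.zpowers (r 1 : DihedralGroup p) :=
    ⟨i.val, by simp⟩
  have h := exists_addMonoidHom_zmod (r 1 : DihedralGroup p) (ι := Bool)
    (fun b ↦ if b then 1 else sr 0) (fun F hF g ↦ ?_) n hn0 hn
  · rwa [orderOf_r_one] at h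
  have h1 (i : ZMod p) : F (r i) = F 1 := by simpa using hF (r i) (hr i) 1
  have h2 (i : ZMod p) : F (sr i) = F (sr 0) := by
    simpa [r_mul_sr] using hF (r (-i)) (hr (-i)) (sr 0)
  rcases g with i | i
  · simp [h1, h2 i]
  · simp [h1, h2 i, add_comm]

lemma exists_addMonoidHom_zmod_reflection (n : ℕ) (hn0 : n ≠ 0) (hn : Even n) :
    ∃ ψ : groupCohomology (Rep.trivial ℤ (DihedralGroup p) ℤ) n →+ ZMod 2,
      ∀ x, ψ x = 0 → p • x = 0 := by
  have h := exists_addMonoidHom_zmod (sr 0 : DihedralGroup p) (ι := ZMod p) r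
    (fun F hF g ↦ ?_) n hn0 hn
  · rwa [orderOf_sr, ZMod.card] at h
  rcases g with i | i
  · simpa using Equiv.sum_comp (Equiv.addRight i) fun x ↦ F (r x)
  · have h1 (x : ZMod p) : F (r x * sr i) = F (r (i - x)) := by
      simpa using hF (sr 0) (Subgroup.mem_zpowers _) (r (i - x))
    simp only [h1]
    exact Equiv.sum_comp (Equiv.subLeft i) fun x ↦ F (r x)

end DihedralGroup

end

/-- For `p` an odd prime and `G = D_{2p}` the dihedral group of order `2p`, the group
cohomology `H^n(G; ℤ)` with trivial coefficients is isomorphic to `ℤ/2p` whenever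
`n ≥ 4` and `n ≡ 0 (mod 4)`. -/
theorem dihedral_trivial_cohomology_zero_mod_four (p : ℕ) (hp : p.Prime) (hodd : Odd p)
    (n : ℕ) (hn4 : 4 ≤ n) (hn : n % 4 = 0) :
    Nonempty (groupCohomology (Rep.trivial ℤ (DihedralGroup p) ℤ) n ≃+ ZMod (2 * p)) := by
  have : NeZero p := ⟨hp.ne_zero⟩
  have hn0 : n ≠ 0 := by omega
  have heven : Even n := Nat.even_iff.2 (by omega)
  obtain ⟨φ, hφ⟩ := DihedralGroup.exists_addMonoidHom_zmod_rotations (p := p) n hn0 heven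
  obtain ⟨ψ, hψ⟩ := DihedralGroup.exists_addMonoidHom_zmod_reflection (p := p) n hn0 heven
  obtain ⟨k, rfl⟩ : ∃ k, n = 4 * k + 4 := ⟨n / 4 - 1, by omega⟩
  exact AddCommGroup.nonempty_addEquiv_zmod_two_mul hp hodd φ ψ hφ hψ
    (DihedralGroup.exists_two_torsion _ hn0 heven)
    (DihedralGroup.exists_torsion_trivial hodd hp.ne_one k)
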